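/- If F, F' ⊆ Δ, w ∈ W, x ∈ a_F⁺ and w·x ∈ a_{F'}⁺, then F = F' and w·x = x. In particular, two distinct faces a_F⁺ and a_{F'}⁺ of the closed dominant chamber are never conjugate under W. -/

import Mathlib

open scoped RealInnerProductSpace

namespace Face
variable {V : Type*} [NormedAddCommGroup V] [InnerProductSpace ℝ V]

/-- reflection in the hyperplane orthogonal to `a` -/
noncomputable def s (a v : V) : V := v - (2 * ⟪a, v⟫ / ⟪a, a⟫) • a

theorem inner_s (a v w : V) : ⟪s a v, w⟫ = ⟪v, w⟫ - 2 * ⟪a, v⟫ / ⟪a, a⟫ * ⟪a, w⟫ := by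
  simp only [s, inner_sub_left, real_inner_smul_left]

theorem inner_s_comm (a v w : V) : ⟪s a v, w⟫ = ⟪v, s a w⟫ := by
  rw [real_inner_comm (s a w) v, inner_s, inner_s, real_inner_comm v w]; ring

theorem s_s (a v : V) : s a (s a v) = v := by
  by_cases h : a = 0
  · simp [s, h]
  have h' : ⟪a, a⟫ ≠ 0 := inner_self_ne_zero.mpr h
  simp only [s, inner_sub_right, real_inner_smul_right]
  rw [sub_sub, ← add_smul]
  have : 2 * ⟪a, v⟫ / ⟪a, a⟫ + 2 * (⟪a, v⟫ - 2 * ⟪a, v⟫ / ⟪a, a⟫ * ⟪a, a⟫) / ⟪a, a⟫ = 0 := by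
    field_simp; ring
  rw [this]; simp

theorem inner_s_s (a v w : V) : ⟪s a v, s a w⟫ = ⟪v, w⟫ := by
  rw [inner_s_comm, s_s]

theorem s_sub_smul (a v w : V) (c : ℝ) : s a (v - c • w) = s a v - c • s a w := by
  simp only [s, inner_sub_right, real_inner_smul_right]
  module

theorem s_conj (g b v : V) : s (s g b) (s g v) = s g (s b v) := by
  rw [s, inner_s_s, inner_s_s, ← s_sub_smul]; rfl

theorem s_smul (a v : V) (c : ℝ) (hc : c ≠ 0) : s (c • a) v = s a v := by
  by_cases h : a = 0
  · simp [s, h]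
  have h' : ⟪a, a⟫ ≠ 0 := inner_self_ne_zero.mpr h
  simp only [s, real_inner_smul_left, real_inner_smul_right, smul_smul]
  congr 2
  field_simp

theorem s_self (a : V) : s a a = -a := by
  by_cases h : a = 0
  · simp [s, h]
  have h' : ⟪a, a⟫ ≠ 0 := inner_self_ne_zero.mpr h
  rw [s, mul_div_assoc, div_self h']; module

/-- the product of the reflections in a list -/
noncomputable def act (L : List V) (x : V) : V := L.foldr s x
/-- the inverse product -/
noncomputable def actI (L : List V) (x : V) : V := L.foldl (fun v b => s b v) x

theorem inner_act (L : List V) : ∀ x y : V, ⟪act L x, y⟫ = ⟪x, actI L y⟫ := by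
  induction L with
  | nil => intro x y; rfl
  | cons b L ih =>
    intro x y
    change ⟪s b (act L x), y⟫ = ⟪x, actI L (s b y)⟫
    rw [inner_s_comm, ih]

theorem act_append (L M : List V) (x : V) : act (L ++ M) x = act L (act M x) := by
  simp [act]

theorem act_reverse (L : List V) : ∀ x : V, act L (act L.reverse x) = x := by
  induction L with
  | nil => intro x; rfl
  | cons b L ih =>
    intro x
    rw [List.reverse_cons, act_append]
    change s b (act L (act L.reverse (s b x))) = x
    rw [ih, s_s]

/-- positive roots -/
def Pos (R : Finset V) (u a : V) : Prop := a ∈ R ∧ 0 < ⟪u, a⟫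

/-- simple roots, intrinsically -/
def Simp (R : Finset V) (u g : V) : Prop :=
  Pos R u g ∧ ∀ b, Pos R u b → ⟪u, s g b⟫ < 0 → ∀ v, s b v = s g v

section
variable {R : Finset V} {u : V}

theorem actI_mem (hR : ∀ a ∈ R, ∀ b ∈ R, s a b ∈ R)
    (hu : ∀ a ∈ R, ⟪u, a⟫ ≠ 0) (L : List V) (hL : ∀ g ∈ L, Simp R u g) :
    ∀ b ∈ R, actI L b ∈ R := by
  induction L with
  | nil => intro b hb; exact hb
  | cons g L ih =>
    intro b hb
    exact ih (fun g' h => hL g' (List.mem_cons_of_mem _ h)) _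
      (hR g (hL g List.mem_cons_self).1.1 b hb)

theorem exchange (hR : ∀ a ∈ R, ∀ b ∈ R, s a b ∈ R)
    (hu : ∀ a ∈ R, ⟪u, a⟫ ≠ 0) (L : List V) (hL : ∀ g ∈ L, Simp R u g) :
    ∀ b, Pos R u b → ⟪u, actI L b⟫ < 0 → ∃ M : List V, M.length < L.length ∧
      (∀ g ∈ M, Simp R u g) ∧ ∀ v, s b (act L v) = act M v := by
  induction L with
  | nil => intro b hb h; exact absurd hb.2 (not_lt.mpr h.le)
  | cons g L ih =>
    intro b hb h
    have hg := hL g List.mem_cons_self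
    have hL' : ∀ g ∈ L, Simp R u g := fun g' h => hL g' (List.mem_cons_of_mem _ h)
    have hm := hR g hg.1.1 b hb.1
    rcases lt_or_gt_of_ne (hu _ hm) with h1 | h1
    · refine ⟨L, by simp, hL', fun v => ?_⟩
      rw [hg.2 b hb h1]
      exact s_s _ _
    · obtain ⟨M, hM1, hM2, hM3⟩ := ih hL' (s g b) ⟨hm, h1⟩ h
      refine ⟨g :: M, by simpa using hM1, ?_, fun v => ?_⟩
      · intro g' hg'
        rcases List.mem_cons.mp hg' with rfl | h2
        · exact hg
        · exact hM2 _ h2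
      · change s b (s g (act L v)) = s g (act M v)
        rw [← hM3, ← s_conj g (s g b), s_s]

theorem key (hR : ∀ a ∈ R, ∀ b ∈ R, s a b ∈ R)
    (hu : ∀ a ∈ R, ⟪u, a⟫ ≠ 0) (x z : V) (hx : ∀ b, Pos R u b → 0 ≤ ⟪b, x⟫)
    (hz : ∀ b, Pos R u b → 0 ≤ ⟪b, z⟫) (n : ℕ) : ∀ L : List V, L.length = n →
      (∀ g ∈ L, Simp R u g) → ⟪act L x, z⟫ ≤ ⟪x, z⟫ := by
  induction n using Nat.strong_induction_on with
  | _ n ih =>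
  intro L hn hL
  cases L with
  | nil => exact le_rfl
  | cons b L =>
    have hb := hL b List.mem_cons_self
    have hL' : ∀ g ∈ L, Simp R u g := fun g' h => hL g' (List.mem_cons_of_mem _ h)
    have hlen : L.length + 1 = n := by simpa using hn
    have hm := actI_mem hR hu L hL' b hb.1.1
    change ⟪s b (act L x), z⟫ ≤ _
    rcases lt_or_gt_of_ne (hu _ hm) with h1 | h1
    · obtain ⟨M, hM1, hM2, hM3⟩ := exchange hR hu L hL' b hb.1 h1
      rw [hM3]
      exact ih M.length (by omega) M rfl hM2
    · have h2 := ih L.length (by omega) L rfl hL'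
      have h3 : 0 ≤ ⟪b, act L x⟫ := by
        rw [real_inner_comm, inner_act, real_inner_comm]
        exact hx _ ⟨hm, h1⟩
      have h4 := hz b hb.1
      have h5 : 0 ≤ 2 * ⟪b, act L x⟫ / ⟪b, b⟫ * ⟪b, z⟫ :=
        mul_nonneg (div_nonneg (by linarith) real_inner_self_nonneg) h4
      rw [inner_s]; linarith

/-- every positive root pairs positively with a simple root -/
theorem exists_simple [DecidableEq V] (hR : ∀ a ∈ R, ∀ b ∈ R, s a b ∈ R)
    (hu : ∀ a ∈ R, ⟪u, a⟫ ≠ 0) (D : Finset V) (hD : ∀ b ∈ D, Pos R u b)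
    (hc : ∀ a, Pos R u a → ∃ c : V → ℝ, (∀ b ∈ D, 0 ≤ c b) ∧ a = ∑ b ∈ D, c b • b) :
    ∀ a, Pos R u a → ∃ g, Simp R u g ∧ 0 < ⟪g, a⟫ := by
  induction hn : D.card using Nat.strong_induction_on generalizing D with
  | _ n ih =>
  by_cases hmin : ∃ b ∈ D, ∃ c : V → ℝ, (∀ d ∈ D.erase b, 0 ≤ c d) ∧ b = ∑ d ∈ D.erase b, c d • d
  · obtain ⟨b, hb, c, hc0, hbc⟩ := hmin
    refine ih (D.erase b).card (hn ▸ Finset.card_erase_lt_of_mem hb) (D.erase b)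
      (fun d hd => hD d (Finset.mem_of_mem_erase hd)) ?_ rfl
    intro a ha
    obtain ⟨e, he, hae⟩ := hc a ha
    refine ⟨fun d => e d + e b * c d, fun d hd => add_nonneg (he d (Finset.mem_of_mem_erase hd))
      (mul_nonneg (he b hb) (hc0 d hd)), ?_⟩
    simp only [add_smul, mul_smul, Finset.sum_add_distrib, ← Finset.smul_sum]
    rw [← hbc, hae, Finset.sum_erase_add _ _ hb]
  · intro a ha
    obtain ⟨e, he, hae⟩ := hc a ha
    have ha0 : 0 < ⟪a, a⟫ := by
      refine lt_of_le_of_ne real_inner_self_nonneg (fun h => ?_)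
      have : a = 0 := inner_self_eq_zero.mp h.symm
      have h2 := ha.2
      simp [this] at h2
    have hex : ∃ g ∈ D, 0 < ⟪g, a⟫ := by
      by_contra hcon
      push Not at hcon
      have : ⟪a, a⟫ ≤ 0 := by
        nth_rewrite 1 [hae]
        rw [sum_inner]
        refine Finset.sum_nonpos fun d hd => ?_
        rw [real_inner_smul_left]
        exact mul_nonpos_of_nonneg_of_nonpos (he d hd) (hcon d hd)
      linarith
    obtain ⟨g, hg, hga⟩ := hex
    refine ⟨g, ⟨hD g hg, ?_⟩, hga⟩
    intro b hb hneg v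
    have hnb : Pos R u (- s g b) := by
      have h1 := hR g (hD g hg).1 b hb.1
      have h2 := hR _ h1 _ h1
      rw [s_self] at h2
      exact ⟨h2, by rw [inner_neg_right]; linarith⟩
    obtain ⟨c, hc0, hbc⟩ := hc b hb
    obtain ⟨d, hd0, hbd⟩ := hc _ hnb
    set k : ℝ := 2 * ⟪g, b⟫ / ⟪g, g⟫ with hk
    have hs : s g b = b - k • g := rfl
    rw [← Finset.sum_erase_add _ _ hg] at hbc hbd
    have hsum : ∑ t ∈ D.erase g, (c t + d t) • t = (k - c g - d g) • g := by
      simp only [add_smul, Finset.sum_add_distrib]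
      have e1 : ∑ t ∈ D.erase g, c t • t = b - c g • g := by rw [hbc]; abel_nf
      have e2 : ∑ t ∈ D.erase g, d t • t = - s g b - d g • g := by rw [hbd]; abel_nf
      rw [e1, e2, hs]; module
    have hpos : ∀ t ∈ D.erase g, 0 ≤ c t + d t := fun t ht =>
      add_nonneg (hc0 t (Finset.mem_of_mem_erase ht)) (hd0 t (Finset.mem_of_mem_erase ht))
    rcases lt_or_ge 0 (k - c g - d g) with hq | hq
    · exfalso
      refine hmin ⟨g, hg, fun t => (k - c g - d g)⁻¹ * (c t + d t), fun t ht =>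
        mul_nonneg (inv_nonneg.mpr hq.le) (hpos t ht), ?_⟩
      simp only [mul_smul, ← Finset.smul_sum]
      rw [hsum, smul_smul, inv_mul_cancel₀ hq.ne', one_smul]
    · have hi : ∑ t ∈ D.erase g, (c t + d t) * ⟪u, t⟫ = (k - c g - d g) * ⟪u, g⟫ := by
        have := congrArg (fun y => ⟪u, y⟫) hsum
        simpa [inner_sum, real_inner_smul_right] using this
      have hnn : ∀ t ∈ D.erase g, 0 ≤ (c t + d t) * ⟪u, t⟫ := fun t ht =>
        mul_nonneg (hpos t ht) (hD t (Finset.mem_of_mem_erase ht)).2.le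
      have hz : ∑ t ∈ D.erase g, (c t + d t) * ⟪u, t⟫ = 0 := by
        refine le_antisymm ?_ (Finset.sum_nonneg hnn)
        rw [hi]
        exact mul_nonpos_of_nonpos_of_nonneg hq (hD g hg).2.le
      have hz' := (Finset.sum_eq_zero_iff_of_nonneg hnn).mp hz
      have hct : ∀ t ∈ D.erase g, c t = 0 := by
        intro t ht
        have h1 := hz' t ht
        have h2 := (hD t (Finset.mem_of_mem_erase ht)).2
        have h3 := hc0 t (Finset.mem_of_mem_erase ht)
        have h4 := hd0 t (Finset.mem_of_mem_erase ht)
        rcases mul_eq_zero.mp h1 with h | h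
        · linarith
        · exact absurd h h2.ne'
      have hbg : b = c g • g := by
        have : ∑ t ∈ D.erase g, c t • t = 0 :=
          Finset.sum_eq_zero fun t ht => by rw [hct t ht, zero_smul]
        rw [this, zero_add] at hbc
        exact hbc
      have hcg : c g ≠ 0 := by
        intro h
        have h2 := hb.2
        rw [hbg, h] at h2
        simp at h2
      rw [hbg, s_smul _ _ _ hcg]

theorem refl_word (hR : ∀ a ∈ R, ∀ b ∈ R, s a b ∈ R)
    (hu : ∀ a ∈ R, ⟪u, a⟫ ≠ 0) (hS : ∀ a, Pos R u a → ∃ g, Simp R u g ∧ 0 < ⟪g, a⟫) :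
    ∀ n : ℕ, ∀ a, Pos R u a → (R.filter (fun b => ⟪u, b⟫ < ⟪u, a⟫)).card = n →
      ∃ L : List V, (∀ g ∈ L, Simp R u g) ∧ ∀ v, s a v = act L v := by
  intro n
  induction n using Nat.strong_induction_on with
  | _ n ih =>
  intro a ha hn
  obtain ⟨g, hg, hga⟩ := hS a ha
  have hm := hR g hg.1.1 a ha.1
  rcases lt_or_gt_of_ne (hu _ hm) with h1 | h1
  · exact ⟨[g], by simpa using hg, fun v => hg.2 a ha h1 v⟩
  · have hg0 : 0 < ⟪g, g⟫ := by
      refine lt_of_le_of_ne real_inner_self_nonneg (fun h => ?_)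
      have : g = 0 := inner_self_eq_zero.mp h.symm
      simp [this] at hga
    have hlt : ⟪u, s g a⟫ < ⟪u, a⟫ := by
      have hug : 0 < ⟪g, u⟫ := by rw [real_inner_comm]; exact hg.1.2
      have : 0 < 2 * ⟪g, a⟫ / ⟪g, g⟫ * ⟪g, u⟫ := by positivity
      rw [real_inner_comm, inner_s, real_inner_comm a u]
      linarith [real_inner_comm a u]
    have hcard : (R.filter (fun b => ⟪u, b⟫ < ⟪u, s g a⟫)).card < n := by
      rw [← hn]
      refine Finset.card_lt_card ?_
      rw [Finset.ssubset_iff_of_subset]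
      · exact ⟨s g a, by simp [hm, hlt], by simp⟩
      · intro b hb
        simp only [Finset.mem_filter] at hb ⊢
        exact ⟨hb.1, hb.2.trans hlt⟩
    obtain ⟨L, hL, hLv⟩ := ih _ hcard (s g a) ⟨hm, h1⟩ rfl
    refine ⟨g :: (L ++ [g]), ?_, fun v => ?_⟩
    · intro g' hg'
      simp only [List.mem_cons, List.mem_append, List.not_mem_nil, or_false] at hg'
      rcases hg' with rfl | h | rfl
      · exact hg
      · exact hL _ h
      · exact hg
    · change _ = s g (act (L ++ [g]) v)
      rw [act_append]
      change _ = s g (act L (s g v))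
      rw [← hLv, s_conj, s_s]

end
end Face

/-- Distinct faces of the closed dominant chamber are never conjugate under the
Weyl group: if `x` lies in the face attached to `F ⊆ Δ` and `w x` lies in the face
attached to `F' ⊆ Δ`, then `F = F'` and `w x = x`. -/
theorem stmt_2 {V : Type*} [DecidableEq V] [NormedAddCommGroup V] [InnerProductSpace ℝ V]
    [FiniteDimensional ℝ V]
    (Rts : Finset V) (hRts0 : (0 : V) ∉ Rts)
    (hrefl : ∀ α ∈ Rts, ∀ β ∈ Rts, β - (2 * ⟪α, β⟫ / ⟪α, α⟫) • α ∈ Rts)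
    (W : Subgroup (V ≃ₗᵢ[ℝ] V))
    (hW : W = Subgroup.closure
      {f : V ≃ₗᵢ[ℝ] V | ∃ α ∈ Rts, ∀ v : V, f v = v - (2 * ⟪α, v⟫ / ⟪α, α⟫) • α})
    (u : V) (hu : ∀ α ∈ Rts, ⟪u, α⟫ ≠ 0)
    (P : Set V) (hP : P = {α ∈ (Rts : Set V) | 0 < ⟪u, α⟫})
    -- Δ is the set of simple roots for the positive system P
    (Δ : Finset V) (hΔP : ↑Δ ⊆ P)
    (hΔ : ∀ α ∈ P, ∃ c : V → ℝ, (∀ β ∈ Δ, 0 ≤ c β) ∧ α = ∑ β ∈ Δ, c β • β)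
    (F F' : Finset V) (hF : F ⊆ Δ) (hF' : F' ⊆ Δ)
    (w : V ≃ₗᵢ[ℝ] V) (hw : w ∈ W) (x : V)
    (hx₁ : ∀ α ∈ F, ⟪α, x⟫ = 0) (hx₂ : ∀ β ∈ Δ \ F, 0 < ⟪β, x⟫)
    (hwx₁ : ∀ α ∈ F', ⟪α, w x⟫ = 0) (hwx₂ : ∀ β ∈ Δ \ F', 0 < ⟪β, w x⟫) :
    F = F' ∧ w x = x := by
  subst hP
  have hR : ∀ a ∈ Rts, ∀ b ∈ Rts, Face.s a b ∈ Rts := hrefl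
  have hD : ∀ b ∈ Δ, Face.Pos Rts u b := fun b hb => hΔP hb
  have hS := Face.exists_simple hR hu Δ hD (fun a ha => hΔ a ha)
  have hword : ∃ L : List V, (∀ g ∈ L, Face.Simp Rts u g) ∧ ∀ v, w v = Face.act L v := by
    rw [hW] at hw
    clear hwx₁ hwx₂
    induction hw using Subgroup.closure_induction with
    | mem f hf =>
      obtain ⟨a, ha, hfa⟩ := hf
      rcases lt_or_gt_of_ne (hu a ha) with h | h
      · have hna : Face.Pos Rts u (-a) := by
          have h2 := hR a ha a ha
          rw [Face.s_self] at h2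
          exact ⟨h2, by rw [inner_neg_right]; linarith⟩
        obtain ⟨L, hL, hLv⟩ := Face.refl_word hR hu hS _ _ hna rfl
        refine ⟨L, hL, fun v => ?_⟩
        rw [← hLv, hfa, ← neg_one_smul ℝ a, Face.s_smul _ _ _ (by norm_num)]
        rfl
      · obtain ⟨L, hL, hLv⟩ := Face.refl_word hR hu hS _ a ⟨ha, h⟩ rfl
        refine ⟨L, hL, fun v => ?_⟩
        rw [← hLv, hfa]
        rfl
    | one => exact ⟨[], by simp, fun v => rfl⟩
    | mul f g _ _ ihf ihg =>
      obtain ⟨L, hL, hLv⟩ := ihf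
      obtain ⟨M, hM, hMv⟩ := ihg
      refine ⟨L ++ M, ?_, fun v => ?_⟩
      · intro g' hg'
        rcases List.mem_append.mp hg' with h | h
        · exact hL _ h
        · exact hM _ h
      · rw [Face.act_append, ← hMv, ← hLv]; rfl
    | inv f _ ihf =>
      obtain ⟨L, hL, hLv⟩ := ihf
      refine ⟨L.reverse, fun g hg => hL g (List.mem_reverse.mp hg), fun v => ?_⟩
      apply f.injective
      rw [hLv (Face.act _ _), Face.act_reverse]
      exact f.apply_symm_apply v
  obtain ⟨L, hL, hLv⟩ := hword
  have dom : ∀ (G : Finset V) (y : V), (∀ α ∈ G, ⟪α, y⟫ = 0) → (∀ β ∈ Δ \ G, 0 < ⟪β, y⟫) →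
      ∀ b, Face.Pos Rts u b → 0 ≤ ⟪b, y⟫ := by
    intro G y h1 h2 b hb
    obtain ⟨c, hc, hbc⟩ := hΔ b hb
    rw [hbc, sum_inner]
    refine Finset.sum_nonneg fun d hd => ?_
    rw [real_inner_smul_left]
    refine mul_nonneg (hc d hd) ?_
    by_cases hdG : d ∈ G
    · exact (h1 d hdG).ge
    · exact (h2 d (Finset.mem_sdiff.mpr ⟨hd, hdG⟩)).le
  have hk := Face.key hR hu x (w x) (dom F x hx₁ hx₂) (dom F' (w x) hwx₁ hwx₂) _ L rfl hL
  rw [← hLv] at hk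
  have hn : ⟪w x, w x⟫ = ⟪x, x⟫ := w.inner_map_map x x
  have heq : w x = x := by
    rw [← sub_eq_zero, ← inner_self_eq_zero (𝕜 := ℝ)]
    refine le_antisymm ?_ real_inner_self_nonneg
    rw [real_inner_sub_sub_self]
    have hcm : ⟪w x, x⟫ = ⟪x, w x⟫ := real_inner_comm _ _
    linarith
  refine ⟨?_, heq⟩
  rw [heq] at hwx₁ hwx₂
  ext a
  constructor
  · intro ha
    by_contra hna
    have := hwx₂ a (Finset.mem_sdiff.mpr ⟨hF ha, hna⟩)
    rw [hx₁ a ha] at this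
    exact lt_irrefl _ this
  · intro ha
    by_contra hna
    have := hx₂ a (Finset.mem_sdiff.mpr ⟨hF' ha, hna⟩)
    rw [hwx₁ a ha] at this
    exact lt_irrefl _ this
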